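/- arXiv:0803.1129 — 3 statements merged into one kernel-verified Lean document; each statement's English description precedes it below -/
import Mathlib

section
/- Let q be a Stirling permutation of length 2n and let q' be the Stirling permutation of length 2(n+1) obtained from q by inserting the pair (n+1)(n+1) into gap j ∈ {0,1,...,2n}. Then the number of ascents of q' equals the number of ascents of q plus 1 minus the indicator that gap j is an ascent of q; the number of descents of q' equals the number of descents of q plus 1 minus the indicator that gap j is a descent of q; and the number of plateaux of q' equals the number of plateaux of q plus 1 minus the indicator that gap j is a plateau of q. Equivalently, the insertion destroys the ascent, descent or plateau at gap j and creates exactly one new ascent, one new plateau and one new descent. -/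
/-- A Stirling permutation of length `2*n`. -/
def IsStirlingPerm (n : ℕ) (l : List ℕ) : Prop :=
  l.length = 2 * n ∧
  (∀ i : ℕ, 1 ≤ i → i ≤ n → l.count i = 2) ∧
  ∀ p q r : Fin l.length, p < q → q < r → l.get p = l.get r → l.get p < l.get q

/-- The extended sequence `a_0 a_1 … a_{2n} a_{2n+1}` with the convention
`a_0 = a_{2n+1} = 0`: `ext l i = a_i`. -/
def ext (l : List ℕ) (i : ℕ) : ℕ := if i = 0 then 0 else l.getD (i - 1) 0

/-- The number of ascents of `l`: indices `i ∈ {0,…,2n}` with `a_i < a_{i+1}`. -/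
def ascents (l : List ℕ) : ℕ :=
  ((Finset.range (l.length + 1)).filter (fun i => ext l i < ext l (i + 1))).card

/-- The number of descents of `l`: indices `i ∈ {0,…,2n}` with `a_i > a_{i+1}`. -/
def descents (l : List ℕ) : ℕ :=
  ((Finset.range (l.length + 1)).filter (fun i => ext l i > ext l (i + 1))).card

/-- The number of plateaux of `l`: indices `i ∈ {0,…,2n}` with `a_i = a_{i+1}`. -/
def plateaux (l : List ℕ) : ℕ :=
  ((Finset.range (l.length + 1)).filter (fun i => ext l i = ext l (i + 1))).card

/-- Inserting the two consecutive entries `(n+1)(n+1)` into gap `j` of a sequence. -/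
def insertPair (n : ℕ) (l : List ℕ) (j : ℕ) : List ℕ :=
  l.take j ++ [n + 1, n + 1] ++ l.drop j

theorem IsStirlingPerm.le_of_mem {n : ℕ} {l : List ℕ} (h : IsStirlingPerm n l) {x : ℕ}
    (hx : x ∈ l) : x ≤ n := by
  obtain ⟨hlen, hcount, -⟩ := h
  have hsum : ∑ i ∈ Finset.Icc 1 n, l.count i = 2 * n := by
    rw [Finset.sum_congr rfl fun i hi =>
      hcount i (Finset.mem_Icc.1 hi).1 (Finset.mem_Icc.1 hi).2]
    simp [mul_comm]
  by_contra hxn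
  have hsub : insert x (Finset.Icc 1 n) ⊆ insert x (Finset.Icc 1 n) ∪ l.toFinset :=
    Finset.subset_union_left
  have htotal : ∑ i ∈ insert x (Finset.Icc 1 n) ∪ l.toFinset, l.count i = l.length := by
    simpa using Multiset.sum_count_eq_card (m := (l : Multiset ℕ))
      (s := insert x (Finset.Icc 1 n) ∪ l.toFinset) fun a ha =>
        Finset.mem_union_right _ (List.mem_toFinset.2 ha)
  have hle := Finset.sum_le_sum_of_subset (f := fun i => l.count i) hsub
  rw [Finset.sum_insert (by simp; omega)] at hle
  have := List.count_pos_iff.2 hx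
  omega

theorem IsStirlingPerm.ext_le {n : ℕ} {l : List ℕ} (h : IsStirlingPerm n l) (i : ℕ) :
    ext l i ≤ n := by
  unfold ext
  split_ifs
  · exact n.zero_le
  · by_cases hi : i - 1 < l.length
    · rw [List.getD_eq_getElem _ _ hi]
      exact h.le_of_mem (List.getElem_mem hi)
    · rw [List.getD_eq_default _ _ (by omega)]
      exact n.zero_le

theorem ext_insertPair (n : ℕ) {l : List ℕ} {j : ℕ} (hj : j ≤ l.length) (i : ℕ) :
    ext (insertPair n l j) i =
      if i ≤ j then ext l i else if i ≤ j + 2 then n + 1 else ext l (i - 2) := by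
  unfold ext insertPair
  rw [List.getD_eq_getElem?_getD, List.getD_eq_getElem?_getD, List.getD_eq_getElem?_getD,
    List.append_assoc, List.getElem?_append, List.getElem?_append, List.getElem?_take,
    List.getElem?_drop, List.length_take, min_eq_left hj]
  by_cases h1 : i ≤ j
  · grind
  rw [if_neg (by omega : ¬i = 0), if_neg h1, if_neg (by omega : ¬i - 1 < j)]
  by_cases h2 : i ≤ j + 2
  · obtain rfl | rfl : i = j + 1 ∨ i = j + 2 := by omega
    all_goals simp
  rw [if_neg h2, if_neg (by simp; omega), if_neg (by omega : ¬i - 2 = 0),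
    show j + (i - 1 - j - [n + 1, n + 1].length) = i - 2 - 1 by simp; omega]

theorem length_insertPair (n : ℕ) {l : List ℕ} {j : ℕ} (hj : j ≤ l.length) :
    (insertPair n l j).length = l.length + 2 := by
  simp [insertPair]
  omega

/-- Inserting a pair at gap `j` replaces the adjacent pair at gap `j` by three new ones. -/
theorem card_filter_insertPair (R : ℕ → ℕ → Prop) [DecidableRel R] (n : ℕ) {l : List ℕ} {j : ℕ}
    (hj : j ≤ l.length) :
    ((Finset.range ((insertPair n l j).length + 1)).filter
        (fun i => R (ext (insertPair n l j) i) (ext (insertPair n l j) (i + 1)))).card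
      + (if R (ext l j) (ext l (j + 1)) then 1 else 0)
      = ((Finset.range (l.length + 1)).filter (fun i => R (ext l i) (ext l (i + 1)))).card
        + (if R (ext l j) (n + 1) then 1 else 0) + (if R (n + 1) (n + 1) then 1 else 0)
        + (if R (n + 1) (ext l (j + 1)) then 1 else 0) := by
  obtain ⟨k, hk⟩ := Nat.exists_eq_add_of_le hj
  rw [length_insertPair n hj, hk, show j + k + 2 + 1 = j + 1 + 1 + 1 + k by ring,
    show j + k + 1 = j + 1 + k by ring]
  have hlow : ∀ i ≤ j, ext (insertPair n l j) i = ext l i := fun i hi => by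
    rw [ext_insertPair n hj, if_pos hi]
  have hmid : ∀ i, j < i → i ≤ j + 2 → ext (insertPair n l j) i = n + 1 := fun i h₁ h₂ => by
    rw [ext_insertPair n hj, if_neg (by omega), if_pos h₂]
  have hhigh : ∀ i, ext (insertPair n l j) (j + 1 + 1 + 1 + i) = ext l (j + 1 + i) := fun i => by
    rw [ext_insertPair n hj, if_neg (by omega), if_neg (by omega),
      show j + 1 + 1 + 1 + i - 2 = j + 1 + i by omega]
  simp only [Finset.card_filter]
  rw [Finset.sum_range_add _ _ k, Finset.sum_range_add _ _ k]
  simp only [Finset.sum_range_succ _ j, Finset.sum_range_succ _ (j + 1),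
    Finset.sum_range_succ _ (j + 1 + 1)]
  rw [Finset.sum_congr rfl fun i hi => by
      rw [hlow i (Finset.mem_range.1 hi).le, hlow (i + 1) (Finset.mem_range.1 hi)],
    Finset.sum_congr (s₁ := Finset.range k) rfl fun i _ => by
      rw [hhigh i, add_assoc (j + 1 + 1 + 1) i 1, hhigh (i + 1), ← add_assoc],
    hlow j le_rfl, hmid (j + 1) (by omega) (by omega), hmid (j + 1 + 1) (by omega) (by omega),
    show ext (insertPair n l j) (j + 1 + 1 + 1) = ext l (j + 1) from hhigh 0]
  ring

/-- Inserting the pair `(n+1)(n+1)` into gap `j` of a Stirling permutation `q` destroys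
the ascent, descent or plateau at gap `j` and creates exactly one new ascent, one new
plateau and one new descent: each of the three statistics of `q' = insertPair n q j`
equals the corresponding statistic of `q`, plus `1`, minus the indicator that gap `j`
is an ascent (resp. descent, plateau) of `q`. -/
theorem insertPair_ascents_descents_plateaux (n : ℕ) (q : List ℕ) (j : ℕ)
    (hq : IsStirlingPerm n q) (hj : j ≤ 2 * n) :
    ascents (insertPair n q j)
      = ascents q + 1 - (if ext q j < ext q (j + 1) then 1 else 0) ∧
    descents (insertPair n q j)
      = descents q + 1 - (if ext q j > ext q (j + 1) then 1 else 0) ∧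
    plateaux (insertPair n q j)
      = plateaux q + 1 - (if ext q j = ext q (j + 1) then 1 else 0) := by
  have hjl : j ≤ q.length := hq.1 ▸ hj
  have hleft := hq.ext_le j
  have hright := hq.ext_le (j + 1)
  refine ⟨?_, ?_, ?_⟩
  · have := card_filter_insertPair (· < ·) n hjl
    rw [if_pos (by omega : ext q j < n + 1), if_neg (by omega : ¬n + 1 < n + 1),
      if_neg (by omega : ¬n + 1 < ext q (j + 1))] at this
    unfold ascents
    omega
  · have := card_filter_insertPair (· > ·) n hjl
    rw [if_neg (by omega : ¬ext q j > n + 1), if_neg (by omega : ¬n + 1 > n + 1),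
      if_pos (by omega : n + 1 > ext q (j + 1))] at this
    unfold descents
    omega
  · have := card_filter_insertPair (· = ·) n hjl
    rw [if_neg (by omega : ¬ext q j = n + 1), if_pos rfl,
      if_neg (by omega : ¬n + 1 = ext q (j + 1))] at this
    unfold plateaux
    omega
end

section
/- Let C_{n,k} denote the number of Stirling permutations of length 2n having exactly k plateaux. Then for all n ≥ 2 and all k ≥ 1, C_{n,k} = k·C_{n-1,k} + (2n-k)·C_{n-1,k-1}, with initial conditions C_{1,k} = 1 if k = 1 and 0 otherwise, and C_{n,0} = 0 for all n ≥ 1. -/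
/-- `C n k` is the number of Stirling permutations of length `2n` with exactly `k` plateaux. -/
noncomputable def C (n k : ℕ) : ℕ :=
  {l : List ℕ | IsStirlingPerm n l ∧ plateaux l = k}.ncard

/-- Insert two adjacent copies of `m` into `l` at the gap `j`. -/
def insertTwice (m j : ℕ) (l : List ℕ) : List ℕ := l.take j ++ m :: m :: l.drop j

theorem forall_get_iff_forall_sublist (l : List ℕ) :
    (∀ p q r : Fin l.length, p < q → q < r → l.get p = l.get r → l.get p < l.get q) ↔
      ∀ a b, [a, b, a].Sublist l → a < b := by
  constructor
  · intro h a b hab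
    obtain ⟨f, hf⟩ := List.sublist_iff_exists_fin_orderEmbedding_get_eq.1 hab
    have h0 := hf ⟨0, by simp⟩
    have h1 := hf ⟨1, by simp⟩
    have h2 := hf ⟨2, by simp⟩
    simp only [List.get_eq_getElem, List.getElem_cons_zero, List.getElem_cons_succ] at h0 h1 h2
    have := h (f ⟨0, by simp⟩) (f ⟨1, by simp⟩) (f ⟨2, by simp⟩)
      (f.lt_iff_lt.2 (by simp)) (f.lt_iff_lt.2 (by simp))
    simp only [List.get_eq_getElem, ← h0, ← h1, ← h2] at this
    exact this trivial
  · intro h p q r hpq hqr hpr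
    apply h
    have : [l.get p, l.get q, l.get r].Sublist l := by
      have := List.map_getElem_sublist (l := l) (is := [p, q, r])
        (by simp [hpq, hqr, hpq.trans hqr])
      simpa using this
    rwa [← hpr] at this

namespace IsStirlingPerm

variable {n : ℕ} {l : List ℕ}

theorem mem_bounds (h : IsStirlingPerm n l) {a : ℕ} (ha : a ∈ l) : 1 ≤ a ∧ a ≤ n := by
  by_contra hcon
  have h1 : ∑ i ∈ l.toFinset ∪ Finset.Icc 1 n, (l : Multiset ℕ).count i = l.length := by
    rw [Multiset.sum_count_eq_card]
    · simp
    · intro b hb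
      simp at hb
      simp [hb]
  have h2 : ∑ i ∈ insert a (Finset.Icc 1 n), (l : Multiset ℕ).count i
      ≤ ∑ i ∈ l.toFinset ∪ Finset.Icc 1 n, (l : Multiset ℕ).count i := by
    apply Finset.sum_le_sum_of_subset
    intro b hb
    simp only [Finset.mem_insert, Finset.mem_union, List.mem_toFinset] at hb ⊢
    rcases hb with rfl | hb
    · exact Or.inl ha
    · exact Or.inr hb
  have h3 : ∑ i ∈ Finset.Icc 1 n, (l : Multiset ℕ).count i = 2 * n := by
    rw [Finset.sum_congr rfl (g := fun _ => 2)]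
    · simp [mul_comm]
    · intro i hi
      simp only [Finset.mem_Icc] at hi
      simpa using h.2.1 i hi.1 hi.2
  rw [Finset.sum_insert (by simpa using hcon), h1, h3, h.1] at h2
  have : 0 < l.count a := List.count_pos_iff.2 ha
  rw [Multiset.coe_count] at h2
  omega

theorem succ_notMem (h : IsStirlingPerm n l) : n + 1 ∉ l := fun hm => by
  have := (h.mem_bounds hm).2
  omega

theorem sublist_lt (h : IsStirlingPerm n l) {a b : ℕ} (hab : [a, b, a].Sublist l) : a < b :=
  (forall_get_iff_forall_sublist l).1 h.2.2 a b hab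

end IsStirlingPerm

theorem filter_insertTwice {m : ℕ} {l : List ℕ} (j : ℕ) (hm : m ∉ l) :
    (insertTwice m j l).filter (· ≠ m) = l := by
  have h : ∀ a ∈ l, a ≠ m := fun a ha e => hm (e ▸ ha)
  have h1 : (l.take j).filter (· ≠ m) = l.take j :=
    List.filter_eq_self.2 fun a ha => by simpa using h a (List.mem_of_mem_take ha)
  have h2 : (l.drop j).filter (· ≠ m) = l.drop j :=
    List.filter_eq_self.2 fun a ha => by simpa using h a (List.mem_of_mem_drop ha)
  simp only [insertTwice, List.filter_append, h1]
  rw [List.filter_cons_of_neg (by simp), List.filter_cons_of_neg (by simp), h2,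
    List.take_append_drop]

theorem idxOf_insertTwice {m j : ℕ} {l : List ℕ} (hj : j ≤ l.length) (hm : m ∉ l) :
    (insertTwice m j l).idxOf m = j := by
  rw [insertTwice, List.idxOf_append_of_notMem fun h => hm (List.mem_of_mem_take h)]
  simp [hj]

theorem count_insertTwice (m j a : ℕ) (l : List ℕ) :
    (insertTwice m j l).count a = l.count a + if m = a then 2 else 0 := by
  have : l.count a = (l.take j).count a + (l.drop j).count a := by
    rw [← List.count_append, List.take_append_drop]
  rw [this, insertTwice, List.count_append, List.count_cons, List.count_cons]
  by_cases h : m = a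
  · simp [h]
    omega
  · simp [h]

theorem length_insertTwice (m j : ℕ) (l : List ℕ) :
    (insertTwice m j l).length = l.length + 2 := by
  simp [insertTwice]
  omega

theorem IsStirlingPerm.insertTwice {n : ℕ} {l : List ℕ} (h : IsStirlingPerm n l) (j : ℕ) :
    IsStirlingPerm (n + 1) (insertTwice (n + 1) j l) := by
  have hm := h.succ_notMem
  refine ⟨by rw [length_insertTwice, h.1]; ring, fun i hi hi' => ?_,
    (forall_get_iff_forall_sublist _).2 fun a b hab => ?_⟩
  · rw [count_insertTwice]
    rcases hi'.eq_or_lt with rfl | hlt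
    · simp [List.count_eq_zero.2 hm]
    · rw [h.2.1 i hi (by omega), if_neg (by omega)]
  · have hmem : ∀ c ∈ [a, b, a], c = n + 1 ∨ c ∈ l := by
      intro c hc
      have := hab.subset hc
      simp only [_root_.insertTwice, List.mem_append, List.mem_cons] at this
      rcases this with h | h | h | h
      · exact Or.inr (List.mem_of_mem_take h)
      · exact Or.inl h
      · exact Or.inl h
      · exact Or.inr (List.mem_of_mem_drop h)
    by_cases ha : a = n + 1
    · subst ha
      exfalso
      obtain ⟨l₁, l₂, e, h₁, h₂⟩ := List.sublist_append_iff.1 hab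
      cases l₁ with
      | cons c l₁ =>
        simp only [List.cons_append, List.cons.injEq] at e
        exact hm (List.mem_of_mem_take (h₁.subset (by simp [e.1])))
      | nil =>
        simp only [List.nil_append] at e
        subst e
        rw [List.cons_sublist_cons] at h₂
        have h₃ : [n + 1].Sublist (l.drop j) := h₂.tail
        exact hm (List.mem_of_mem_drop (h₃.subset (by simp)))
    · have ha' : a ∈ l := (hmem a (by simp)).resolve_left ha
      have := (h.mem_bounds ha').2
      rcases hmem b (by simp) with rfl | hb
      · omega
      · apply h.sublist_lt
        have hb' : b ≠ n + 1 := fun e => hm (e ▸ hb)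
        have := hab.filter (· ≠ n + 1)
        rw [filter_insertTwice j hm] at this
        simpa [ha, hb'] using this

theorem IsStirlingPerm.exists_eq_insertTwice {n : ℕ} {l : List ℕ}
    (h : IsStirlingPerm (n + 1) l) :
    ∃ l' j, IsStirlingPerm n l' ∧ j ≤ l'.length ∧ _root_.insertTwice (n + 1) j l' = l := by
  have hc := h.2.1 (n + 1) (by omega) le_rfl
  obtain ⟨x, y, rfl, hx⟩ := List.eq_append_cons_of_mem
    (List.count_pos_iff.1 (by rw [hc]; norm_num : 0 < l.count (n + 1)))
  have hy : y.count (n + 1) = 1 := by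
    simpa [List.count_eq_zero.2 hx] using hc
  obtain ⟨z, w, rfl, hz⟩ := List.eq_append_cons_of_mem
    (List.count_pos_iff.1 (by rw [hy]; norm_num : 0 < y.count (n + 1)))
  cases z with
  | cons b z =>
    exfalso
    have h1 := (h.mem_bounds (a := b) (by simp)).2
    have h2 : n + 1 < b := h.sublist_lt (by
      refine List.Sublist.trans ?_ (List.sublist_append_right _ _)
      simp)
    omega
  | nil =>
    have e : _root_.insertTwice (n + 1) x.length (x ++ w) =
        x ++ (n + 1) :: ([] ++ (n + 1) :: w) := by
      simp [_root_.insertTwice]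
    refine ⟨x ++ w, x.length, ⟨?_, fun i hi hi' => ?_, ?_⟩, by simp, e⟩
    · have := h.1
      rw [← e, length_insertTwice] at this
      omega
    · have := h.2.1 i hi (by omega)
      rwa [← e, count_insertTwice, if_neg (by omega), add_zero] at this
    · refine (forall_get_iff_forall_sublist _).2 fun a b hab => h.sublist_lt (hab.trans ?_)
      simp

theorem ext_insertTwice_of_le {m j i : ℕ} {l : List ℕ} (hj : j ≤ l.length) (hi : i ≤ j) :
    ext (insertTwice m j l) i = ext l i := by
  unfold ext insertTwice
  split_ifs with h
  · rfl
  · simp only [List.getD_eq_getElem?_getD]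
    rw [List.getElem?_append_left (by rw [List.length_take]; omega),
      List.getElem?_take_of_lt (by omega)]

theorem ext_insertTwice_add {m j : ℕ} {l : List ℕ} (hj : j ≤ l.length) (d : ℕ) :
    ext (insertTwice m j l) (j + 1 + d) = (m :: m :: l.drop j).getD d 0 := by
  simp only [ext, insertTwice, List.getD_eq_getElem?_getD]
  rw [if_neg (by omega), List.getElem?_append_right (by rw [List.length_take]; omega)]
  congr 2
  simp
  omega

theorem plateaux_insertTwice {m j : ℕ} {l : List ℕ} (hj : j ≤ l.length) (hm0 : m ≠ 0)
    (hm : m ∉ l) :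
    plateaux (insertTwice m j l) =
      plateaux l + if ext l j = ext l (j + 1) then 0 else 1 := by
  have hne : ∀ i, ext l i ≠ m := by
    intro i e
    unfold ext at e
    split_ifs at e with h
    · exact hm0 e.symm
    · by_cases hi : i - 1 < l.length
      · rw [List.getD_eq_getElem _ _ hi] at e
        exact hm (e ▸ List.getElem_mem hi)
      · rw [List.getD_eq_default _ _ (by omega)] at e
        exact hm0 e.symm
  have e1 := ext_insertTwice_add (m := m) hj 0
  have e2 := ext_insertTwice_add (m := m) hj 1
  have e3 : ∀ d, ext (insertTwice m j l) (j + 1 + (d + 2)) = ext l (j + 1 + d) := by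
    intro d
    rw [ext_insertTwice_add hj]
    simp only [ext, List.getD_eq_getElem?_getD, List.getElem?_cons_succ, List.getElem?_drop]
    rw [if_neg (by omega)]
    congr 2
    omega
  simp only [List.getD_cons_zero, List.getD_cons_succ, add_zero] at e1 e2
  obtain ⟨d, hd⟩ := Nat.exists_eq_add_of_le hj
  simp only [plateaux, Finset.card_filter, length_insertTwice]
  rw [show l.length + 2 + 1 = (j + 1 + 1 + 1) + d by omega,
    show l.length + 1 = (j + 1) + d by omega]
  simp only [Finset.sum_range_add, Finset.sum_range_succ]
  have s1 : ∀ i ∈ Finset.range j,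
      (if ext (insertTwice m j l) i = ext (insertTwice m j l) (i + 1) then 1 else 0) =
        if ext l i = ext l (i + 1) then 1 else 0 := by
    intro i hi
    rw [Finset.mem_range] at hi
    rw [ext_insertTwice_of_le hj hi.le, ext_insertTwice_of_le hj hi]
  have s2 : ∀ i ∈ Finset.range d,
      (if ext (insertTwice m j l) (j + 1 + 1 + 1 + i) =
        ext (insertTwice m j l) (j + 1 + 1 + 1 + i + 1) then 1 else 0) =
        if ext l (j + 1 + i) = ext l (j + 1 + i + 1) then 1 else 0 := by
    intro i _
    rw [show j + 1 + 1 + 1 + i = j + 1 + (i + 2) by ring, e3,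
      show j + 1 + (i + 2) + 1 = j + 1 + (i + 1 + 2) by ring, e3,
      show j + 1 + (i + 1) = j + 1 + i + 1 by ring]
  have e4 := e3 0
  rw [Finset.sum_congr rfl s1, Finset.sum_congr rfl s2, e1, e2,
    show j + 1 + 1 + 1 = j + 1 + (0 + 2) by ring, e4, ext_insertTwice_of_le hj le_rfl,
    if_neg (hne j), if_neg (hne _).symm, if_pos rfl]
  split_ifs <;> omega

theorem ext_ne_ext_succ_of_plateaux_eq_zero {l : List ℕ} (h : plateaux l = 0) {j : ℕ}
    (hj : j ≤ l.length) : ext l j ≠ ext l (j + 1) := by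
  intro e
  exact Finset.filter_eq_empty_iff.1 (Finset.card_eq_zero.1 h)
    (Finset.mem_range.2 (Nat.lt_succ_of_le hj)) e

theorem finite_setOf_isStirlingPerm (n : ℕ) : {l : List ℕ | IsStirlingPerm n l}.Finite := by
  induction n with
  | zero =>
    refine (Set.finite_singleton []).subset fun l hl => ?_
    simpa using hl.1
  | succ n ih =>
    refine ((ih.prod (Set.finite_Iic (2 * n))).image
      fun p => insertTwice (n + 1) p.2 p.1).subset fun l hl => ?_
    obtain ⟨l', j, hl', hj, rfl⟩ := IsStirlingPerm.exists_eq_insertTwice hl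
    exact ⟨(l', j), ⟨hl', by simpa [hl'.1] using hj⟩, rfl⟩

theorem C_eq_card (n k : ℕ) :
    C n k = ((finite_setOf_isStirlingPerm n).toFinset.filter (plateaux · = k)).card := by
  rw [C, ← Set.ncard_coe_finset]
  congr 1
  ext l
  simp

theorem C_succ (n k : ℕ) :
    C (n + 1) (k + 1) = (k + 1) * C n (k + 1) + (2 * n + 1 - k) * C n k := by
  classical
  set S := (finite_setOf_isStirlingPerm n).toFinset with hS
  have memS : ∀ l, l ∈ S ↔ IsStirlingPerm n l := by simp [hS]
  set A := (S.filter (plateaux · = k + 1)).sigma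
    fun l => (Finset.range (l.length + 1)).filter fun i => ext l i = ext l (i + 1) with hA
  set B := (S.filter (plateaux · = k)).sigma
    fun l => (Finset.range (l.length + 1)).filter fun i => ¬ ext l i = ext l (i + 1) with hB
  have cA : A.card = (k + 1) * C n (k + 1) := by
    rw [hA, Finset.card_sigma, Finset.sum_const_nat (m := k + 1), C_eq_card, mul_comm]
    intro l hl
    exact (Finset.mem_filter.1 hl).2
  have cB : B.card = (2 * n + 1 - k) * C n k := by
    rw [hB, Finset.card_sigma, Finset.sum_const_nat (m := 2 * n + 1 - k), C_eq_card, mul_comm]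
    intro l hl
    rw [Finset.mem_filter, memS] at hl
    have := Finset.card_filter_add_card_filter_not (s := Finset.range (l.length + 1))
      (fun i => ext l i = ext l (i + 1))
    rw [Finset.card_range, hl.1.1] at this
    have h2 : plateaux l = k := hl.2
    rw [plateaux, hl.1.1] at h2
    rw [hl.1.1]
    omega
  have hAB : Disjoint A B := by
    rw [Finset.disjoint_left]
    rintro ⟨l, j⟩ h1 h2
    simp only [hA, hB, Finset.mem_sigma, Finset.mem_filter] at h1 h2
    exact h2.2.2 h1.2.2
  have mem : ∀ p : (_ : List ℕ) × ℕ, p ∈ A ∪ B ↔ IsStirlingPerm n p.1 ∧ p.2 ≤ p.1.length ∧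
      plateaux (insertTwice (n + 1) p.2 p.1) = k + 1 := by
    rintro ⟨l, j⟩
    simp only [hA, hB, Finset.mem_union, Finset.mem_sigma, Finset.mem_filter, memS,
      Finset.mem_range, Nat.lt_succ_iff]
    by_cases h : IsStirlingPerm n l <;> by_cases hj : j ≤ l.length <;>
      simp only [h, hj, false_and, true_and, and_false, or_self]
    rw [plateaux_insertTwice hj (by omega) h.succ_notMem]
    split_ifs with he <;> simp [he]
  rw [← cA, ← cB, ← Finset.card_union_of_disjoint hAB, C_eq_card]
  symm
  refine Finset.card_bij (fun p _ => insertTwice (n + 1) p.2 p.1) ?_ ?_ ?_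
  · intro p hp
    rw [mem] at hp
    simpa [hp.2.2] using hp.1.insertTwice p.2
  · rintro ⟨l, j⟩ hp ⟨l', j'⟩ hp' e
    rw [mem] at hp hp'
    dsimp only at hp hp' e
    have hl : l = l' := by
      rw [← filter_insertTwice j hp.1.succ_notMem, e, filter_insertTwice j' hp'.1.succ_notMem]
    have hj : j = j' := by
      rw [← idxOf_insertTwice hp.2.1 hp.1.succ_notMem, e,
        idxOf_insertTwice hp'.2.1 hp'.1.succ_notMem]
    rw [hl, hj]
  · intro l hl
    simp only [Finset.mem_filter, Set.Finite.mem_toFinset, Set.mem_ofPred_eq] at hl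
    obtain ⟨l', j, hl', hj, rfl⟩ := hl.1.exists_eq_insertTwice
    exact ⟨⟨l', j⟩, (mem _).2 ⟨hl', hj, hl.2⟩, rfl⟩

theorem C_succ_zero (n : ℕ) : C (n + 1) 0 = 0 := by
  rw [C_eq_card, Finset.card_eq_zero, Finset.filter_eq_empty_iff]
  intro l hl h0
  simp only [Set.Finite.mem_toFinset, Set.mem_ofPred_eq] at hl
  obtain ⟨l', j, hl', hj, rfl⟩ := hl.exists_eq_insertTwice
  rw [plateaux_insertTwice hj (by omega) hl'.succ_notMem] at h0
  have := ext_ne_ext_succ_of_plateaux_eq_zero (l := l') (by omega) hj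
  rw [if_neg this] at h0
  omega

theorem C_zero (k : ℕ) : C 0 k = if k = 1 then 1 else 0 := by
  have hp : plateaux [] = 1 := by decide
  have hs : ∀ l, IsStirlingPerm 0 l ↔ l = [] := by
    refine fun l => ⟨fun h => by simpa using h.1, ?_⟩
    rintro rfl
    exact ⟨rfl, fun i hi hi' => by omega, fun p => p.elim0⟩
  simp only [C, hs]
  split_ifs with hk
  · rw [Set.ncard_eq_one]
    refine ⟨[], Set.ext fun l => ?_⟩
    simp only [Set.mem_ofPred_eq, Set.mem_singleton_iff, and_iff_left_iff_imp]
    rintro rfl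
    rw [hp, hk]
  · convert Set.ncard_empty (List ℕ)
    rw [Set.eq_empty_iff_forall_notMem]
    rintro l ⟨rfl, h⟩
    exact hk (h ▸ hp)

/-- The second-order Eulerian recursion: for `n ≥ 2` and `k ≥ 1`,
`C_{n,k} = k C_{n-1,k} + (2n-k) C_{n-1,k-1}`, with the initial conditions
`C_{1,k} = [k = 1]` and `C_{n,0} = 0` for `n ≥ 1`. -/
theorem second_order_eulerian_recursion :
    (∀ n k : ℕ, 2 ≤ n → 1 ≤ k →
      C n k = k * C (n - 1) k + (2 * n - k) * C (n - 1) (k - 1)) ∧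
    (∀ k : ℕ, C 1 k = if k = 1 then 1 else 0) ∧
    (∀ n : ℕ, 1 ≤ n → C n 0 = 0) := by
  refine ⟨fun n k hn hk => ?_, fun k => ?_, fun n hn => ?_⟩
  · obtain ⟨n, rfl⟩ := Nat.exists_eq_add_of_le' (show 1 ≤ n by omega)
    obtain ⟨k, rfl⟩ := Nat.exists_eq_add_of_le' hk
    rw [C_succ, Nat.add_sub_cancel, Nat.add_sub_cancel,
      show 2 * (n + 1) - (k + 1) = 2 * n + 1 - k by omega]
  · cases k with
    | zero => simpa using C_succ_zero 0
    | succ k =>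
      rw [C_succ 0 k, C_zero, C_zero]
      rcases k with _ | _ | k <;> simp
  · obtain ⟨n, rfl⟩ := Nat.exists_eq_add_of_le' hn
    exact C_succ_zero n
end

section
/- For each n ≥ 1 and each nonnegative integer k, the number of Stirling permutations of length 2n with exactly k ascents equals the number with exactly k descents, and also equals the number with exactly k plateaux. Equivalently, the numbers of ascents, of descents, and of plateaux of a uniformly random Stirling permutation of length 2n are identically distributed: X_n, Y_n and Z_n have the same distribution. -/
/-- The number of adjacent pairs related by `R` in the sequence `a, l₀, l₁, …, 0`. -/
def adjacentCount (R : ℕ → ℕ → Prop) [DecidableRel R] : ℕ → List ℕ → ℕ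
  | a, [] => if R a 0 then 1 else 0
  | a, b :: l => (if R a b then 1 else 0) + adjacentCount R b l

/-- All ways of inserting two adjacent copies of `N` in a list. -/
def doubleInsertions (N : ℕ) : List ℕ → List (List ℕ)
  | [] => [[N, N]]
  | b :: l => (N :: N :: b :: l) :: (doubleInsertions N l).map (b :: ·)

/-- The list of all Stirling permutations of length `2 * n`. -/
def stirlingPerms : ℕ → List (List ℕ)
  | 0 => [[]]
  | n + 1 => (stirlingPerms n).flatMap (doubleInsertions (n + 1))

theorem card_filter_range_getD (R : ℕ → ℕ → Prop) [DecidableRel R] (a : ℕ) (l : List ℕ) :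
    ((Finset.range (l.length + 1)).filter
      (fun i => R ((a :: l).getD i 0) ((a :: l).getD (i + 1) 0))).card
      = adjacentCount R a l := by
  induction l generalizing a with
  | nil => simp [adjacentCount, Finset.filter_singleton, apply_ite Finset.card]
  | cons b l ih =>
    rw [Finset.card_filter, List.length_cons, Finset.sum_range_succ', adjacentCount, ← ih b,
      Finset.card_filter, add_comm]
    rfl

theorem ext_eq_getD (l : List ℕ) (i : ℕ) : ext l i = (0 :: l).getD i 0 := by
  cases i <;> simp [ext]

theorem ascents_eq_adjacentCount (l : List ℕ) : ascents l = adjacentCount (· < ·) 0 l := by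
  simp only [ascents, ext_eq_getD, ← card_filter_range_getD]

theorem descents_eq_adjacentCount (l : List ℕ) : descents l = adjacentCount (· > ·) 0 l := by
  simp only [descents, ext_eq_getD, ← card_filter_range_getD]

theorem plateaux_eq_adjacentCount (l : List ℕ) : plateaux l = adjacentCount (· = ·) 0 l := by
  simp only [plateaux, ext_eq_getD, ← card_filter_range_getD]

theorem adjacentCount_le (R : ℕ → ℕ → Prop) [DecidableRel R] (a : ℕ) (l : List ℕ) :
    adjacentCount R a l ≤ l.length + 1 := by
  induction l generalizing a with
  | nil => simp only [adjacentCount]; split <;> simp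
  | cons b l ih =>
    have := ih b
    simp only [adjacentCount, List.length_cons]
    split <;> omega

theorem mem_doubleInsertions {N : ℕ} {l m : List ℕ} :
    l ∈ doubleInsertions N m ↔ ∃ A C, m = A ++ C ∧ l = A ++ N :: N :: C := by
  induction m generalizing l with
  | nil => simp [doubleInsertions]
  | cons b m ih =>
    simp only [doubleInsertions, List.mem_cons, List.mem_map, ih]
    constructor
    · rintro (rfl | ⟨_, ⟨A, C, rfl, rfl⟩, rfl⟩)
      · exact ⟨[], _, rfl, rfl⟩
      · exact ⟨b :: A, C, rfl, rfl⟩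
    · rintro ⟨_ | ⟨a, A⟩, C, h, rfl⟩
      · left; simp_all
      · simp only [List.cons_append, List.cons.injEq] at h
        obtain ⟨rfl, rfl⟩ := h
        exact Or.inr ⟨_, ⟨A, C, rfl, rfl⟩, rfl⟩

theorem nodup_doubleInsertions {N : ℕ} {m : List ℕ} (h : N ∉ m) :
    (doubleInsertions N m).Nodup := by
  induction m with
  | nil => simp [doubleInsertions]
  | cons b m ih =>
    simp only [List.mem_cons, not_or] at h
    simp only [doubleInsertions, List.nodup_cons, List.mem_map, not_exists, not_and]
    exact ⟨fun _ _ e => h.1 (List.cons.inj e).1.symm,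
      (ih h.2).map (List.cons_injective)⟩

theorem filter_ne_eq_self {N : ℕ} {m : List ℕ} (h : N ∉ m) : m.filter (· ≠ N) = m := by
  rw [List.filter_eq_self]
  intro a ha
  simpa using fun e : a = N => h (e ▸ ha)

theorem filter_ne_of_mem_doubleInsertions {N : ℕ} {l m : List ℕ} (h : N ∉ m)
    (hl : l ∈ doubleInsertions N m) : l.filter (· ≠ N) = m := by
  obtain ⟨A, C, rfl, rfl⟩ := mem_doubleInsertions.1 hl
  rw [← filter_ne_eq_self h]
  simp

/-- Among the insertions of two copies of a maximum `N`, those at a gap counted by `R` preserve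
the count, and the others increase it by one. -/
theorem map_adjacentCount_doubleInsertions_perm (R : ℕ → ℕ → Prop) [DecidableRel R] {N : ℕ}
    (hR : ∀ a b, a < N → b < N →
      (if R a N then 1 else 0) + (if R N N then 1 else 0) + (if R N b then 1 else 0) = 1)
    {a : ℕ} {m : List ℕ} (ha : a < N) (hm : ∀ x ∈ m, x < N) :
    ((doubleInsertions N m).map (adjacentCount R a)).Perm
      (List.replicate (adjacentCount R a m) (adjacentCount R a m) ++
        List.replicate (m.length + 1 - adjacentCount R a m) (adjacentCount R a m + 1)) := by
  induction m generalizing a with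
  | nil =>
    have := hR a 0 ha (by omega)
    have e : adjacentCount R a [N, N] = 1 := by simp only [adjacentCount]; omega
    by_cases h : R a 0 <;> simp [doubleInsertions, e] <;> simp [adjacentCount, h]
  | cons b m ih =>
    have hb : b < N := hm b (by simp)
    have h1 := hR a b ha hb
    have ih := ih hb fun x hx => hm x (by simp [hx])
    have e : adjacentCount R a (N :: N :: b :: m) = adjacentCount R b m + 1 := by
      simp only [adjacentCount]; omega
    have hle := adjacentCount_le R b m
    have hmap : ((doubleInsertions N m).map (b :: ·)).map (adjacentCount R a)
        = ((doubleInsertions N m).map (adjacentCount R b)).map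
          ((if R a b then 1 else 0) + ·) := by
      simp [Function.comp_def, adjacentCount]
    rw [doubleInsertions, List.map_cons, e, hmap]
    refine ((ih.map _).cons _).trans ?_
    by_cases h : R a b
    · simp [adjacentCount, h, add_comm 1, List.replicate_succ]
    · rw [List.length_cons, adjacentCount, if_neg h, Nat.zero_add,
        Nat.sub_add_comm hle, List.replicate_succ]
      simpa using List.perm_middle.symm

theorem isStirlingPerm_iff (n : ℕ) (l : List ℕ) :
    IsStirlingPerm n l ↔ l.length = 2 * n ∧ (∀ i, 1 ≤ i → i ≤ n → l.count i = 2) ∧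
      ∀ x y, [x, y, x].Sublist l → x < y := by
  unfold IsStirlingPerm
  refine and_congr_right fun _ => and_congr_right fun _ => ⟨fun h x y hs => ?_,
    fun h p q r hpq hqr e => ?_⟩
  · obtain ⟨f, hf⟩ := List.sublist_iff_exists_fin_orderEmbedding_get_eq.1 hs
    have h0 := hf (0 : Fin 3)
    have h1 := hf (1 : Fin 3)
    have h2 := hf (2 : Fin 3)
    have := h (f (0 : Fin 3)) (f (1 : Fin 3)) (f (2 : Fin 3))
      (f.lt_iff_lt.2 (Fin.mk_lt_mk.2 zero_lt_one))
      (f.lt_iff_lt.2 (Fin.mk_lt_mk.2 one_lt_two)) (h0.symm.trans h2)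
    rwa [← h0, ← h1] at this
  · apply h
    have hs : ([p, q, r].map l.get).Sublist l :=
      List.map_getElem_sublist (by simp [hpq, hqr, hpq.trans hqr])
    rwa [List.map_cons, List.map_cons, List.map_cons, List.map_nil, ← e] at hs

theorem IsStirlingPerm.mem_Icc {n : ℕ} {l : List ℕ} (h : IsStirlingPerm n l) {x : ℕ}
    (hx : x ∈ l) : 1 ≤ x ∧ x ≤ n := by
  by_contra hcon
  have hle : ∑ i ∈ insert x (Finset.Icc 1 n), l.count i ≤ l.length := by
    rw [← Multiset.coe_card, ← Multiset.sum_count_eq_card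
      (s := insert x (Finset.Icc 1 n) ∪ l.toFinset) (m := (l : Multiset ℕ)) (by intro a ha; simp_all)]
    simp only [Multiset.coe_count]
    exact Finset.sum_le_sum_of_subset Finset.subset_union_left
  rw [Finset.sum_insert (by simpa using hcon), h.1, Finset.sum_congr rfl fun i hi =>
    h.2.1 i (Finset.mem_Icc.1 hi).1 (Finset.mem_Icc.1 hi).2] at hle
  have := List.count_pos_iff.2 hx
  simp at hle
  omega

theorem IsStirlingPerm.exists_mem_doubleInsertions {n : ℕ} {l : List ℕ}
    (h : IsStirlingPerm (n + 1) l) :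
    ∃ m, IsStirlingPerm n m ∧ l ∈ doubleInsertions (n + 1) m := by
  have hmem := fun {x} (hx : x ∈ l) => h.mem_Icc hx
  obtain ⟨hlen, hcount, hsub⟩ := (isStirlingPerm_iff _ _).1 h
  have hN := hcount (n + 1) (by omega) le_rfl
  obtain ⟨A, D, rfl, hA⟩ := List.eq_append_cons_of_mem
    (List.count_pos_iff.1 (by omega : 0 < l.count (n + 1)))
  rw [List.count_append, List.count_cons_self, List.count_eq_zero_of_not_mem hA] at hN
  obtain ⟨B, C, rfl, hB⟩ := List.eq_append_cons_of_mem
    (List.count_pos_iff.1 (by omega : 0 < D.count (n + 1)))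
  obtain rfl : B = [] := by
    refine List.eq_nil_iff_forall_not_mem.2 fun y hy => ?_
    have hlt : n + 1 < y := hsub (n + 1) y <|
      ((List.Sublist.append (List.singleton_sublist.2 hy)
        (List.singleton_sublist.2 List.mem_cons_self)).cons_cons _).trans
        (List.sublist_append_right _ _)
    have := hmem (x := y) (by simp [hy])
    omega
  refine ⟨A ++ C, (isStirlingPerm_iff _ _).2 ⟨?_, fun i h1 h2 => ?_, fun x y hs => ?_⟩,
    mem_doubleInsertions.2 ⟨A, C, rfl, rfl⟩⟩
  · simp at hlen ⊢
    omega
  · have hne : n + 1 ≠ i := by omega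
    rw [← hcount i h1 (by omega)]
    simp [hne]
  · exact hsub x y (hs.trans (List.Sublist.append_left
      ((List.sublist_cons_self _ _).trans (List.sublist_cons_self _ _)) A))

theorem IsStirlingPerm.of_mem_doubleInsertions {n : ℕ} {l m : List ℕ}
    (hm : IsStirlingPerm n m) (hl : l ∈ doubleInsertions (n + 1) m) :
    IsStirlingPerm (n + 1) l := by
  have hmem := fun {x} (hx : x ∈ m) => hm.mem_Icc hx
  have hN : n + 1 ∉ m := fun hx => by have := hmem hx; omega
  have hfil := filter_ne_of_mem_doubleInsertions hN hl
  obtain ⟨hlen, hcount, hsub⟩ := (isStirlingPerm_iff _ _).1 hm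
  obtain ⟨A, C, rfl, rfl⟩ := mem_doubleInsertions.1 hl
  refine (isStirlingPerm_iff _ _).2 ⟨?_, fun i h1 h2 => ?_, fun x y hs => ?_⟩
  · simp at hlen ⊢
    omega
  · rcases h2.eq_or_lt with rfl | h2
    · rw [List.mem_append, not_or] at hN
      simp [List.count_eq_zero_of_not_mem hN.1, List.count_eq_zero_of_not_mem hN.2]
    · have hne : n + 1 ≠ i := by omega
      rw [← hcount i h1 (by omega)]
      simp [hne]
  · have hx : x ≠ n + 1 := by
      rintro rfl
      simp only [List.mem_append, not_or] at hN
      obtain ⟨_ | ⟨a, l₁⟩, l₂, he, h₁, h₂⟩ := List.sublist_append_iff.1 hs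
      · obtain rfl : [n + 1, y, n + 1] = l₂ := he
        rcases List.sublist_cons_iff.1 (List.cons_sublist_cons.1 h₂) with h | ⟨r, hr, h⟩
        · exact hN.2 (h.subset (by simp))
        · obtain ⟨-, rfl⟩ := List.cons.inj hr
          exact hN.2 (h.subset (by simp))
      · rw [(List.cons.inj he).1] at hN
        exact hN.1 (h₁.subset List.mem_cons_self)
    by_cases hy : y = n + 1
    · have hxm : x ∈ A ++ C := by
        have := hs.subset (a := x) (by simp)
        simpa [hx] using this
      have := hmem hxm
      omega
    · apply hsub
      rw [← hfil]
      simpa [hx, hy] using hs.filter (· ≠ n + 1)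

theorem mem_stirlingPerms {n : ℕ} {l : List ℕ} : l ∈ stirlingPerms n ↔ IsStirlingPerm n l := by
  induction n generalizing l with
  | zero =>
    simp only [stirlingPerms, List.mem_singleton, isStirlingPerm_iff]
    constructor
    · rintro rfl
      simp
      omega
    · rintro ⟨h, -⟩
      simpa using h
  | succ n ih =>
    simp only [stirlingPerms, List.mem_flatMap, ih]
    exact ⟨fun ⟨_, hm, hl⟩ => hm.of_mem_doubleInsertions hl,
      fun h => h.exists_mem_doubleInsertions⟩

theorem succ_notMem_of_mem_stirlingPerms {n : ℕ} {m : List ℕ} (hm : m ∈ stirlingPerms n) :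
    n + 1 ∉ m := fun h => by
  have := (mem_stirlingPerms.1 hm).mem_Icc h
  omega

theorem nodup_stirlingPerms (n : ℕ) : (stirlingPerms n).Nodup := by
  induction n with
  | zero => simp [stirlingPerms]
  | succ n ih =>
    refine List.nodup_flatMap.2
      ⟨fun m hm => nodup_doubleInsertions (succ_notMem_of_mem_stirlingPerms hm),
        ih.pairwise_of_forall_ne fun m hm m' hm' hne l hl hl' => hne ?_⟩
    rw [← filter_ne_of_mem_doubleInsertions (succ_notMem_of_mem_stirlingPerms hm) hl,
      ← filter_ne_of_mem_doubleInsertions (succ_notMem_of_mem_stirlingPerms hm') hl']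

theorem ncard_isStirlingPerm_and_eq (n k : ℕ) (f : List ℕ → ℕ) :
    {l : List ℕ | IsStirlingPerm n l ∧ f l = k}.ncard = ((stirlingPerms n).map f).count k := by
  have : {l : List ℕ | IsStirlingPerm n l ∧ f l = k}
      = ((stirlingPerms n).filter (fun l => f l = k)).toFinset := by
    ext l
    simp [mem_stirlingPerms]
  rw [this, Set.ncard_coe_finset, List.toFinset_card_of_nodup ((nodup_stirlingPerms n).filter _),
    List.count, List.countP_map, List.countP_eq_length_filter]
  rfl

theorem map_adjacentCount_stirlingPerms_succ_perm (R : ℕ → ℕ → Prop) [DecidableRel R] (n : ℕ)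
    (hR : ∀ a b N, a < N → b < N →
      (if R a N then 1 else 0) + (if R N N then 1 else 0) + (if R N b then 1 else 0) = 1) :
    ((stirlingPerms (n + 1)).map (adjacentCount R 0)).Perm
      (((stirlingPerms n).map (adjacentCount R 0)).flatMap fun c =>
        List.replicate c c ++ List.replicate (2 * n + 1 - c) (c + 1)) := by
  rw [stirlingPerms, List.map_flatMap, List.flatMap_map]
  refine List.Perm.flatMap_left _ fun m hm => ?_
  have hm := mem_stirlingPerms.1 hm
  rw [← hm.1]
  exact map_adjacentCount_doubleInsertions_perm R (fun a b => hR a b (n + 1)) n.succ_pos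
    fun x hx => Nat.lt_succ_of_le (hm.mem_Icc hx).2

theorem map_adjacentCount_stirlingPerms_perm (R R' : ℕ → ℕ → Prop) [DecidableRel R]
    [DecidableRel R']
    (hR : ∀ a b N, a < N → b < N →
      (if R a N then 1 else 0) + (if R N N then 1 else 0) + (if R N b then 1 else 0) = 1)
    (hR' : ∀ a b N, a < N → b < N →
      (if R' a N then 1 else 0) + (if R' N N then 1 else 0) + (if R' N b then 1 else 0) = 1)
    {n : ℕ} (hn : 1 ≤ n) :
    ((stirlingPerms n).map (adjacentCount R 0)).Perm
      ((stirlingPerms n).map (adjacentCount R' 0)) := by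
  induction n, hn using Nat.le_induction with
  | base =>
    have h := hR 0 0 1 one_pos one_pos
    have h' := hR' 0 0 1 one_pos one_pos
    simp only [stirlingPerms, doubleInsertions, List.flatMap_cons, List.flatMap_nil,
      List.append_nil, List.map_cons, List.map_nil, adjacentCount, Nat.zero_add, ← add_assoc, h, h']
    rfl
  | succ n _ ih =>
    exact (map_adjacentCount_stirlingPerms_succ_perm R n hR).trans
      ((ih.flatMap_right _).trans (map_adjacentCount_stirlingPerms_succ_perm R' n hR').symm)

/-- For each `n ≥ 1` and each `k`, the number of Stirling permutations of length `2n`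
with exactly `k` ascents equals the number with exactly `k` descents, and also equals
the number with exactly `k` plateaux; i.e. `X_n`, `Y_n` and `Z_n` are identically
distributed. -/
theorem ascents_descents_plateaux_equidistributed (n : ℕ) (hn : 1 ≤ n) (k : ℕ) :
    {l : List ℕ | IsStirlingPerm n l ∧ ascents l = k}.ncard
      = {l : List ℕ | IsStirlingPerm n l ∧ descents l = k}.ncard ∧
    {l : List ℕ | IsStirlingPerm n l ∧ ascents l = k}.ncard
      = {l : List ℕ | IsStirlingPerm n l ∧ plateaux l = k}.ncard := by
  have hlt : ∀ a b N : ℕ, a < N → b < N →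
      (if a < N then 1 else 0) + (if N < N then 1 else 0) + (if N < b then 1 else 0) = 1 := by
    intro a b N ha hb
    simp [ha, hb.le]
  have hgt : ∀ a b N : ℕ, a < N → b < N →
      (if a > N then 1 else 0) + (if N > N then 1 else 0) + (if N > b then 1 else 0) = 1 := by
    intro a b N ha hb
    simp [ha.le, hb]
  have heq : ∀ a b N : ℕ, a < N → b < N →
      (if a = N then 1 else 0) + (if N = N then 1 else 0) + (if N = b then 1 else 0) = 1 := by
    intro a b N ha hb
    simp [ha.ne, hb.ne']
  simp only [ascents_eq_adjacentCount, descents_eq_adjacentCount, plateaux_eq_adjacentCount,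
    ncard_isStirlingPerm_and_eq]
  exact ⟨(map_adjacentCount_stirlingPerms_perm _ _ hlt hgt hn).count_eq k,
    (map_adjacentCount_stirlingPerms_perm _ _ hlt heq hn).count_eq k⟩
end
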